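/- Let α ∈ (0,1) and r = √(1−α²). For every x with r < x < 1, the function U^{μ_α} is differentiable at x with derivative (d/dx) U^{μ_α}(x) = (1/2)·log(1−x²) − log(α + √(x²−r²)). -/

import Mathlib

open MeasureTheory Polynomial Filter Set

/-- The `n`-grid: `n` equally spaced points in `[-1,1]` including the endpoints. -/
noncomputable def nGrid (n : ℕ) : Set ℝ :=
  {x | ∃ k : ℕ, 1 ≤ k ∧ k ≤ n ∧ x = (2 * (k : ℝ) - n - 1) / ((n : ℝ) - 1)}

/-- Uniform norm of a real polynomial on the interval `[-1,1]`. -/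
noncomputable def normI (p : Polynomial ℝ) : ℝ :=
  sSup ((fun x => |p.eval x|) '' Set.Icc (-1 : ℝ) 1)

/-- Uniform norm of a real polynomial on the `n`-grid. -/
noncomputable def normE (n : ℕ) (p : Polynomial ℝ) : ℝ :=
  sSup ((fun x => |p.eval x|) '' nGrid n)

/-- The constant `C(α)`. -/
noncomputable def Cconst (α : ℝ) : ℝ :=
  ((1 + α) * Real.log (1 + α) + (1 - α) * Real.log (1 - α)) / 2

/-- The constraining measure `σ`: density `1/2` w.r.t. Lebesgue measure on `[-1,1]`. -/
noncomputable def sigmaM : Measure ℝ :=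
  (2 : ENNReal)⁻¹ • (volume.restrict (Set.Icc (-1 : ℝ) 1))

/-- Logarithmic potential of a measure on `ℝ`. -/
noncomputable def logPot (μ : Measure ℝ) (x : ℝ) : ℝ :=
  ∫ y, Real.log (1 / |x - y|) ∂μ

/-- Topological support of a measure on `ℝ`. -/
def msupport (μ : Measure ℝ) : Set ℝ :=
  {x | ∀ U : Set ℝ, IsOpen U → x ∈ U → μ U ≠ 0}

/-- Normalized zero counting measure (zeros counted with multiplicity,
normalized by `1/n`). -/
noncomputable def zeroMeasure (n : ℕ) (p : Polynomial ℝ) : Measure ℝ :=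
  ((n : ENNReal))⁻¹ • (p.roots.map (fun x => MeasureTheory.Measure.dirac x)).sum

/-- Density of the constrained equilibrium measure `μ_α` (with `r = √(1-α²)`). -/
noncomputable def mualphaDensity (α x : ℝ) : ℝ :=
  if |x| < Real.sqrt (1 - α ^ 2) then
    (1 / Real.pi) * Real.arctan (α / Real.sqrt ((1 - α ^ 2) - x ^ 2))
  else (1 : ℝ) / 2

/-- The constrained equilibrium measure `μ_α` on `[-1,1]`. -/
noncomputable def mualpha (α : ℝ) : Measure ℝ :=
  (volume.restrict (Set.Icc (-1 : ℝ) 1)).withDensity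
    (fun x => ENNReal.ofReal (mualphaDensity α x))

theorem setIntegral_of_hasDerivAt_of_nonneg_of_eq_zero {g g' : ℝ → ℝ} {a b c d : ℝ}
    (hac : a ≤ c) (hcd : c ≤ d) (hdb : d ≤ b) (hcont : ContinuousOn g (Icc c d))
    (hderiv : ∀ y ∈ Ioo c d, HasDerivAt g (g' y) y) (hpos : ∀ y ∈ Ioo c d, 0 ≤ g' y)
    (hzero : ∀ y ∈ Ioc a b \ Ioc c d, g' y = 0) :
    IntegrableOn g' (Ioc a b) ∧ ∫ y in Ioc a b, g' y = g d - g c := by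
  have hsub : Ioc c d ⊆ Ioc a b := Ioc_subset_Ioc hac hdb
  have hint := intervalIntegral.integrableOn_deriv_of_nonneg hcont hderiv hpos
  refine ⟨hint.of_forall_sdiff_eq_zero measurableSet_Ioc hzero, ?_⟩
  rw [setIntegral_eq_of_subset_of_forall_sdiff_eq_zero measurableSet_Ioc hsub hzero,
    ← intervalIntegral.integral_of_le hcd]
  exact intervalIntegral.integral_eq_sub_of_hasDerivAt_of_le hcd hcont hderiv
    ((intervalIntegrable_iff_integrableOn_Ioc_of_le hcd).2 hint)

theorem sqrt_sub_sq_eq_zero {ρ y : ℝ} (hρ : 0 ≤ ρ) (hy : ρ ≤ |y|) : √(ρ ^ 2 - y ^ 2) = 0 := by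
  refine Real.sqrt_eq_zero_of_nonpos ?_
  have := pow_le_pow_left₀ hρ hy 2
  rw [sq_abs] at this
  linarith

theorem le_abs_of_notMem_Ioc {ρ y : ℝ} (hy : y ∉ Ioc (-ρ) ρ) : ρ ≤ |y| := by
  by_contra! h
  obtain ⟨h1, h2⟩ := abs_lt.1 h
  exact hy ⟨h1, h2.le⟩

theorem hasDerivAt_arcsin_cauchy {ρ x y : ℝ} (hρ : 0 < ρ) (hx : ρ < x) (hy : y ∈ Ioo (-ρ) ρ) :
    HasDerivAt (fun y => (√(x ^ 2 - ρ ^ 2))⁻¹ * Real.arcsin ((x * y - ρ ^ 2) / (ρ * (x - y))))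
      ((√(ρ ^ 2 - y ^ 2))⁻¹ * (x - y)⁻¹) y := by
  have hxy : 0 < x - y := by linarith [hy.2]
  have hA : 0 < x ^ 2 - ρ ^ 2 := by nlinarith
  have hB : 0 < ρ ^ 2 - y ^ 2 := by nlinarith [hy.1, hy.2]
  have hsq : 1 - ((x * y - ρ ^ 2) / (ρ * (x - y))) ^ 2
      = (x ^ 2 - ρ ^ 2) * (ρ ^ 2 - y ^ 2) / (ρ * (x - y)) ^ 2 := by
    field_simp
    ring
  have hpos : 0 < 1 - ((x * y - ρ ^ 2) / (ρ * (x - y))) ^ 2 := by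
    rw [hsq]; positivity
  have hg : HasDerivAt (fun y => (x * y - ρ ^ 2) / (ρ * (x - y)))
      ((x ^ 2 - ρ ^ 2) / (ρ * (x - y) ^ 2)) y := by
    have h1 : HasDerivAt (fun y : ℝ => x * y - ρ ^ 2) x y := by
      simpa using ((hasDerivAt_id y).const_mul x).sub_const (ρ ^ 2)
    have h2 : HasDerivAt (fun y : ℝ => ρ * (x - y)) (-ρ) y := by
      simpa using ((hasDerivAt_id y).const_sub x).const_mul ρ
    refine (h1.div h2 (by positivity)).congr_deriv ?_
    field_simp
    ring
  have harc := Real.hasDerivAt_arcsin (x := (x * y - ρ ^ 2) / (ρ * (x - y)))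
    (by intro h; rw [h] at hpos; norm_num at hpos) (by intro h; rw [h] at hpos; norm_num at hpos)
  refine ((harc.comp y hg).const_mul _).congr_deriv ?_
  rw [hsq, Real.sqrt_div' _ (by positivity), Real.sqrt_sq (by positivity),
    Real.sqrt_mul hA.le]
  have h1 := Real.sqrt_pos.2 hA
  have h2 := Real.sqrt_pos.2 hB
  nth_rewrite 3 [← Real.sq_sqrt hA.le]
  field_simp

/-- The Cauchy transform of the arcsine distribution on `[-ρ, ρ]`, off its support. -/
theorem setIntegral_arcsine_cauchy {ρ r x : ℝ} (hρ : 0 < ρ) (hr : ρ ≤ r) (hx : r < x) :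
    IntegrableOn (fun y => (√(ρ ^ 2 - y ^ 2))⁻¹ * (x - y)⁻¹) (Ioc (-r) r) ∧
      ∫ y in Ioc (-r) r, (√(ρ ^ 2 - y ^ 2))⁻¹ * (x - y)⁻¹ = Real.pi * (√(x ^ 2 - ρ ^ 2))⁻¹ := by
  have hx' : ρ < x := hr.trans_lt hx
  have key := setIntegral_of_hasDerivAt_of_nonneg_of_eq_zero (a := -r) (b := r)
    (c := -ρ) (d := ρ)
    (g := fun y => (√(x ^ 2 - ρ ^ 2))⁻¹ * Real.arcsin ((x * y - ρ ^ 2) / (ρ * (x - y))))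
    (g' := fun y => (√(ρ ^ 2 - y ^ 2))⁻¹ * (x - y)⁻¹)
    (by linarith) (by linarith) hr ?_ (fun y hy => hasDerivAt_arcsin_cauchy hρ hx' hy) ?_ ?_
  · refine ⟨key.1, key.2.trans ?_⟩
    have h1 : (x * ρ - ρ ^ 2) / (ρ * (x - ρ)) = 1 := by
      have : x - ρ ≠ 0 := by linarith
      field_simp
    have h2 : (x * -ρ - ρ ^ 2) / (ρ * (x - -ρ)) = -1 := by
      have : x - -ρ ≠ 0 := by linarith
      field_simp
      ring
    simp only [h1, h2, Real.arcsin_one, Real.arcsin_neg_one]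
    ring
  · refine continuousOn_const.mul (Real.continuous_arcsin.comp_continuousOn ?_)
    refine ContinuousOn.div (by fun_prop) (by fun_prop) fun y hy => ?_
    have : 0 < x - y := by linarith [hy.2]
    positivity
  · intro y hy
    have : 0 < x - y := by linarith [hy.2]
    positivity
  · intro y hy
    simp [sqrt_sub_sq_eq_zero hρ.le (le_abs_of_notMem_Ioc hy.2)]

theorem hasDerivAt_arctan_sqrt_div {a t : ℝ} (ht : 0 < t) (hta : t < a) :
    HasDerivAt (fun t => -Real.arctan (√(a ^ 2 - t ^ 2) / t)) (√(a ^ 2 - t ^ 2))⁻¹ t := by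
  have hB : 0 < a ^ 2 - t ^ 2 := by nlinarith
  have ha : 0 < a := by linarith
  have h1 : HasDerivAt (fun t : ℝ => a ^ 2 - t ^ 2) (-(2 * t)) t := by
    simpa using (hasDerivAt_pow 2 t).const_sub (a ^ 2)
  have h2 := ((h1.sqrt hB.ne').div (hasDerivAt_id t) ht.ne').arctan.neg
  refine h2.congr_deriv ?_
  have hs := Real.sqrt_pos.2 hB
  have hs2 := Real.sq_sqrt hB.le
  simp only [Pi.div_apply, id]
  rw [div_pow, hs2]
  have : (1 + (a ^ 2 - t ^ 2) / t ^ 2) = a ^ 2 / t ^ 2 := by field_simp; ring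
  rw [this]
  field_simp
  rw [hs2]
  ring

theorem setIntegral_inv_sqrt_sub_sq {a α : ℝ} (hα : 0 < α) (hαa : α ≤ a) (ha : a ≤ 1) :
    ∫ t in Ioc α 1, (√(a ^ 2 - t ^ 2))⁻¹ = Real.arctan (√(a ^ 2 - α ^ 2) / α) := by
  have key := (setIntegral_of_hasDerivAt_of_nonneg_of_eq_zero (a := α) (b := 1)
    (c := α) (d := a) (g := fun t => -Real.arctan (√(a ^ 2 - t ^ 2) / t))
    (g' := fun t => (√(a ^ 2 - t ^ 2))⁻¹) le_rfl hαa ha ?_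
    (fun t ht => hasDerivAt_arctan_sqrt_div (hα.trans ht.1) ht.2) (fun t _ => by positivity)
    ?_).2
  · rw [key]; simp
  · refine (Real.continuous_arctan.comp_continuousOn ?_).neg
    exact ContinuousOn.div (by fun_prop) (by fun_prop) fun t ht => (hα.trans_le ht.1).ne'
  · intro t ht
    have h : a ≤ |t| := by
      by_contra! h
      exact ht.2 ⟨ht.1.1, (le_abs_self t).trans h.le⟩
    simp [sqrt_sub_sq_eq_zero (hα.le.trans hαa) h]

theorem setIntegral_inv_sqrt_add {c α : ℝ} (hα : 0 < α) (hα1 : α ≤ 1) (hc : 0 < c + α ^ 2) :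
    IntegrableOn (fun t => (√(c + t ^ 2))⁻¹) (Ioc α 1) ∧
    ∫ t in Ioc α 1, (√(c + t ^ 2))⁻¹ = Real.log (1 + √(c + 1)) - Real.log (α + √(c + α ^ 2)) := by
  have hpos : ∀ t ∈ Icc α 1, 0 < c + t ^ 2 := fun t ht => by nlinarith [ht.1]
  have key := setIntegral_of_hasDerivAt_of_nonneg_of_eq_zero (a := α) (b := 1)
    (c := α) (d := 1) (g := fun t => Real.log (t + √(c + t ^ 2)))
    (g' := fun t => (√(c + t ^ 2))⁻¹) le_rfl hα1 le_rfl ?_ ?_ (fun t _ => by positivity)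
    (fun t ht => absurd ht.1 ht.2)
  · refine ⟨key.1, ?_⟩
    rw [key.2]; simp
  · refine ContinuousOn.log (by fun_prop) fun t ht => ?_
    have : 0 < t := hα.trans_le ht.1
    positivity
  · intro t ht
    have ht0 : 0 < t := hα.trans ht.1
    have hp := hpos t ⟨ht.1.le, ht.2.le⟩
    have hs := Real.sqrt_pos.2 hp
    have h1 : HasDerivAt (fun t : ℝ => c + t ^ 2) (2 * t) t := by
      simpa using (hasDerivAt_pow 2 t).const_add c
    refine (((hasDerivAt_id t).add (h1.sqrt hp.ne')).log (by simp; positivity)).congr_deriv ?_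
    simp only [Pi.add_apply, id]
    field_simp
    ring

/-- The Cauchy transform of `1/2` minus the density of `μ_α`, to the right of its support. -/
theorem setIntegral_arctan_sqrt_cauchy {α r x : ℝ} (hα : α ∈ Ioo (0 : ℝ) 1)
    (hr : r = √(1 - α ^ 2)) (hx : r < x) :
    ∫ y in Ioc (-r) r, Real.arctan (√(r ^ 2 - y ^ 2) / α) * (x - y)⁻¹
      = Real.pi * (Real.log (1 + x) - Real.log (α + √(x ^ 2 - r ^ 2))) := by
  have hα0 := hα.1
  have hα1 := hα.2
  have hr2 : r ^ 2 = 1 - α ^ 2 := by rw [hr, Real.sq_sqrt]; nlinarith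
  have hr0 : 0 < r := by rw [hr]; apply Real.sqrt_pos.2; nlinarith
  have hx0 : 0 < x := hr0.trans hx
  have hinner : ∀ y ∈ Ioc (-r) r, Real.arctan (√(r ^ 2 - y ^ 2) / α) * (x - y)⁻¹
      = ∫ t in Ioc α 1, (√(1 - t ^ 2 - y ^ 2))⁻¹ * (x - y)⁻¹ := by
    intro y hy
    have hy2 : y ^ 2 ≤ r ^ 2 := sq_le_sq' hy.1.le hy.2
    have hsq : √(1 - y ^ 2) ^ 2 = 1 - y ^ 2 := Real.sq_sqrt (by nlinarith)
    have := setIntegral_inv_sqrt_sub_sq (a := √(1 - y ^ 2)) hα0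
      (Real.le_sqrt_of_sq_le (by linarith))
      (Real.sqrt_le_one.2 (by nlinarith [sq_nonneg y]))
    rw [hsq, show 1 - y ^ 2 - α ^ 2 = r ^ 2 - y ^ 2 by linarith] at this
    rw [integral_mul_const, ← this]
    simp only [sub_right_comm]
  have houter : ∀ t ∈ Ioo α 1,
      IntegrableOn (fun y => (√(1 - t ^ 2 - y ^ 2))⁻¹ * (x - y)⁻¹) (Ioc (-r) r) ∧
      ∫ y in Ioc (-r) r, (√(1 - t ^ 2 - y ^ 2))⁻¹ * (x - y)⁻¹
        = Real.pi * (√(x ^ 2 - 1 + t ^ 2))⁻¹ := by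
    intro t ht
    have ht0 := hα0.trans ht.1
    have hp : 0 < 1 - t ^ 2 := by nlinarith [ht.2]
    have := setIntegral_arcsine_cauchy (ρ := √(1 - t ^ 2)) (r := r) (x := x)
      (Real.sqrt_pos.2 hp) (by rw [hr]; apply Real.sqrt_le_sqrt; nlinarith [ht.1]) hx
    rw [Real.sq_sqrt hp.le] at this
    rwa [show x ^ 2 - 1 + t ^ 2 = x ^ 2 - (1 - t ^ 2) by ring]
  have haeIoo : ∀ᵐ t ∂volume.restrict (Ioc α 1), t ∈ Ioo α 1 := by
    rw [← restrict_Ioo_eq_restrict_Ioc]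
    exact ae_restrict_mem measurableSet_Ioo
  have hlog := setIntegral_inv_sqrt_add (c := x ^ 2 - 1) hα0 hα1.le (by nlinarith)
  have hint : Integrable (Function.uncurry fun y t : ℝ => (√(1 - t ^ 2 - y ^ 2))⁻¹ * (x - y)⁻¹)
      ((volume.restrict (Ioc (-r) r)).prod (volume.restrict (Ioc α 1))) := by
    refine (integrable_prod_iff' ?_).2 ⟨?_, ?_⟩
    · apply Measurable.aestronglyMeasurable
      unfold Function.uncurry
      fun_prop
    · filter_upwards [haeIoo] with t ht using (houter t ht).1
    · refine (hlog.1.const_mul Real.pi).congr ?_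
      filter_upwards [haeIoo] with t ht
      rw [← (houter t ht).2]
      refine setIntegral_congr_fun measurableSet_Ioc fun y hy => ?_
      have : 0 < x - y := by linarith [hy.2]
      simp only [Function.uncurry]
      rw [Real.norm_of_nonneg (by positivity)]
  rw [setIntegral_congr_fun measurableSet_Ioc hinner, integral_integral_swap hint,
    integral_congr_ae (haeIoo.mono fun t ht => (houter t ht).2), integral_const_mul, hlog.2]
  rw [show x ^ 2 - 1 + 1 = x ^ 2 by ring, Real.sqrt_sq hx0.le,
    show x ^ 2 - 1 + α ^ 2 = x ^ 2 - r ^ 2 by linarith]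

theorem mualphaDensity_eq {α : ℝ} (hα : α ∈ Ioo (0 : ℝ) 1) (y : ℝ) :
    mualphaDensity α y
      = 1 / 2 - Real.pi⁻¹ * Real.arctan (√(√(1 - α ^ 2) ^ 2 - y ^ 2) / α) := by
  have hα0 := hα.1
  have hp : 0 ≤ 1 - α ^ 2 := by nlinarith [hα.2]
  unfold mualphaDensity
  split_ifs with h
  · have hy : 0 < 1 - α ^ 2 - y ^ 2 := by
      have := pow_lt_pow_left₀ h (abs_nonneg y) two_ne_zero
      rw [sq_abs, Real.sq_sqrt hp] at this
      linarith
    have hs := Real.sqrt_pos.2 hy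
    rw [Real.sq_sqrt hp, ← inv_div √(1 - α ^ 2 - y ^ 2) α, Real.arctan_inv_of_pos (by positivity)]
    field_simp
  · rw [sqrt_sub_sq_eq_zero (Real.sqrt_nonneg _) (not_lt.1 h)]
    simp

theorem mualphaDensity_nonneg {α : ℝ} (hα : 0 ≤ α) (y : ℝ) : 0 ≤ mualphaDensity α y := by
  unfold mualphaDensity
  split_ifs
  · have := Real.arctan_nonneg.2 (div_nonneg hα (Real.sqrt_nonneg (1 - α ^ 2 - y ^ 2)))
    positivity
  · norm_num

theorem intervalIntegrable_log_sub (x a b : ℝ) :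
    IntervalIntegrable (fun y => Real.log (x - y)) volume a b := by
  simpa using (intervalIntegral.intervalIntegrable_log' (a := x - a) (b := x - b)).comp_sub_left x

theorem logPot_mualpha {α r : ℝ} (hα : α ∈ Ioo (0 : ℝ) 1) (hr : r = √(1 - α ^ 2)) (x : ℝ) :
    logPot (mualpha α) x
      = Real.pi⁻¹ * (∫ y in Ioc (-r) r, Real.arctan (√(r ^ 2 - y ^ 2) / α) * Real.log (x - y))
        - 1 / 2 * ((x + 1) * Real.log (x + 1) - (x - 1) * Real.log (x - 1) - 2) := by
  have hα0 := hα.1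
  have hdens : mualphaDensity α
      = fun y => 1 / 2 - Real.pi⁻¹ * Real.arctan (√(r ^ 2 - y ^ 2) / α) := by
    subst hr
    exact funext fun y => mualphaDensity_eq hα y
  have hcont : Continuous fun y => Real.arctan (√(r ^ 2 - y ^ 2) / α) :=
    Real.continuous_arctan.comp (by fun_prop)
  have hmeas : Measurable (mualphaDensity α) := by
    rw [hdens]
    exact (continuous_const.sub (continuous_const.mul hcont)).measurable
  have hr0 : 0 ≤ r := hr ▸ Real.sqrt_nonneg _
  have hr1 : r ≤ 1 := by
    rw [hr]
    exact Real.sqrt_le_one.2 (by nlinarith)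
  have hlog := intervalIntegrable_log_sub x (-1) 1
  have hlog' := hlog.continuousOn_mul (hcont.continuousOn)
  have hsupp : ∫ y in Ioc (-1) 1, Real.arctan (√(r ^ 2 - y ^ 2) / α) * Real.log (x - y)
      = ∫ y in Ioc (-r) r, Real.arctan (√(r ^ 2 - y ^ 2) / α) * Real.log (x - y) := by
    refine setIntegral_eq_of_subset_of_forall_sdiff_eq_zero measurableSet_Ioc
      (Ioc_subset_Ioc (by linarith) hr1) fun y hy => ?_
    simp [sqrt_sub_sq_eq_zero hr0 (le_abs_of_notMem_Ioc hy.2)]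
  have hprim : ∫ y in (-1 : ℝ)..1, Real.log (x - y)
      = (x + 1) * Real.log (x + 1) - (x - 1) * Real.log (x - 1) - 2 := by
    rw [intervalIntegral.integral_comp_sub_left, integral_log]
    ring_nf
  unfold logPot mualpha
  rw [integral_withDensity_eq_integral_toReal_smul hmeas.ennreal_ofReal (by simp),
    integral_Icc_eq_integral_Ioc, ← hsupp, ← hprim,
    ← intervalIntegral.integral_of_le (by norm_num), ← intervalIntegral.integral_of_le (by norm_num),
    ← intervalIntegral.integral_const_mul, ← intervalIntegral.integral_const_mul,
    ← intervalIntegral.integral_sub (hlog'.const_mul _) (hlog.const_mul _)]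
  refine intervalIntegral.integral_congr fun y _ => ?_
  simp only [ENNReal.toReal_ofReal (mualphaDensity_nonneg hα0.le y)]
  simp only [smul_eq_mul, one_div, Real.log_inv, Real.log_abs, hdens]
  ring

/-- Differentiation under the integral sign for a logarithmic potential, off the support. -/
theorem hasDerivAt_setIntegral_mul_log_sub {f : ℝ → ℝ} (hf : Continuous f) {a b x : ℝ}
    (hx : b < x) :
    HasDerivAt (fun x => ∫ y in Ioc a b, f y * Real.log (x - y))
      (∫ y in Ioc a b, f y * (x - y)⁻¹) x := by
  have hε : 0 < (x - b) / 2 := by linarith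
  refine (hasDerivAt_integral_of_dominated_loc_of_deriv_le (s := Ioi ((x + b) / 2))
    (F := fun x y => f y * Real.log (x - y)) (F' := fun x y => f y * (x - y)⁻¹)
    (bound := fun y => |f y| * ((x - b) / 2)⁻¹) (Ioi_mem_nhds (by linarith)) ?_ ?_ ?_ ?_ ?_ ?_).2
  · refine Eventually.of_forall fun z => ?_
    exact (hf.measurable.mul (by fun_prop)).aestronglyMeasurable
  · rcases le_total a b with hab | hab
    · exact (intervalIntegrable_iff_integrableOn_Ioc_of_le hab).1
        ((intervalIntegrable_log_sub x a b).continuousOn_mul hf.continuousOn)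
    · simp [Ioc_eq_empty_of_le hab]
  · exact (hf.measurable.mul (by fun_prop)).aestronglyMeasurable
  · filter_upwards [ae_restrict_mem measurableSet_Ioc] with y hy z hz
    have hz : (x + b) / 2 < z := hz
    have hzy : (x - b) / 2 ≤ z - y := by linarith [hy.2]
    have hzy0 : 0 < z - y := hε.trans_le hzy
    rw [norm_mul, Real.norm_eq_abs, Real.norm_of_nonneg (inv_nonneg.2 hzy0.le)]
    gcongr
  · exact ((by fun_prop : Continuous fun y => |f y| * ((x - b) / 2)⁻¹).integrableOn_Ioc)
  · filter_upwards [ae_restrict_mem measurableSet_Ioc] with y hy z hz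
    have hz : (x + b) / 2 < z := hz
    have hzy : z - y ≠ 0 := by linarith [hy.2]
    simpa using (((hasDerivAt_id z).sub_const y).log hzy).const_mul (f y)

theorem potential_derivative (α : ℝ) (hα : α ∈ Set.Ioo (0 : ℝ) 1)
    (r : ℝ) (hr : r = Real.sqrt (1 - α ^ 2))
    (x : ℝ) (hx : r < x) (hx1 : x < 1) :
    HasDerivAt (logPot (mualpha α))
      ((1 / 2) * Real.log (1 - x ^ 2) - Real.log (α + Real.sqrt (x ^ 2 - r ^ 2))) x := by
  have hx0 : 0 < x := (hr ▸ Real.sqrt_nonneg _ : 0 ≤ r).trans_lt hx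
  have hcont : Continuous fun y => Real.arctan (√(r ^ 2 - y ^ 2) / α) :=
    Real.continuous_arctan.comp (by fun_prop)
  have h1 : HasDerivAt (fun x : ℝ => (x + 1) * Real.log (x + 1)) (Real.log (x + 1) + 1) x :=
    (Real.hasDerivAt_mul_log (by linarith : x + 1 ≠ 0)).comp_add_const x 1
  have h2 : HasDerivAt (fun x : ℝ => (x - 1) * Real.log (x - 1)) (Real.log (x - 1) + 1) x :=
    (Real.hasDerivAt_mul_log (by linarith : x - 1 ≠ 0)).comp_sub_const x 1
  rw [funext (logPot_mualpha hα hr)]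
  refine (((hasDerivAt_setIntegral_mul_log_sub hcont hx).const_mul Real.pi⁻¹).sub
    (((h1.sub h2).sub_const 2).const_mul (1 / 2))).congr_deriv ?_
  rw [setIntegral_arctan_sqrt_cauchy hα hr hx, inv_mul_cancel_left₀ Real.pi_ne_zero,
    show 1 - x ^ 2 = (1 + x) * (1 - x) by ring,
    Real.log_mul (by linarith) (by linarith), ← Real.log_neg_eq_log (x - 1), neg_sub,
    add_comm x 1]
  ring
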